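/- Fix a prime number p and a real number β > 1. For every real λ > 0 the doubly infinite series Z_p(λ,β) = 2 Σ_{k∈ℤ} (a_k(λ) − a_{k−1}(λ)) p^{−kβ} converges absolutely (only finitely many terms with k < 0 are nonzero), and it satisfies the functional equation Z_p(pλ,β) = p^β · Z_p(λ,β). -/

import Mathlib

/-- `a p lam k = ⌈lam * p^k - 1⌉`; note `a p lam k = 0` whenever `lam * p^k ≤ 1`. -/
noncomputable def a (p : ℕ) (lam : ℝ) (k : ℤ) : ℤ := ⌈lam * (p : ℝ) ^ k - 1⌉

/-- The extended partition function
`Zext_p(λ,β) = 2 Σ_{k∈ℤ} (a_k(λ) − a_{k−1}(λ)) p^{−kβ}`. -/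
noncomputable def Zext (p : ℕ) (lam β : ℝ) : ℝ :=
  2 * ∑' k : ℤ, ((a p lam k - a p lam (k - 1) : ℤ) : ℝ) * (p : ℝ) ^ (-(k : ℝ) * β)

theorem a_nonneg {p : ℕ} (hp : p.Prime) {lam : ℝ} (hlam : 0 < lam) (k : ℤ) : 0 ≤ a p lam k := by
  have hp0 : (0 : ℝ) < p := by exact_mod_cast hp.pos
  have h : 0 < lam * (p : ℝ) ^ k := by positivity
  have : (-1 : ℤ) < a p lam k := by
    unfold a
    rw [Int.lt_ceil]
    push_cast
    linarith
  omega

theorem a_le (p : ℕ) (lam : ℝ) (k : ℤ) : (a p lam k : ℝ) ≤ lam * (p : ℝ) ^ k := by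
  have := Int.ceil_lt_add_one (lam * (p : ℝ) ^ k - 1)
  unfold a
  linarith

theorem a_eq_zero {p : ℕ} (hp : p.Prime) {lam : ℝ} (hlam : 0 < lam) {k : ℤ}
    (h : lam * (p : ℝ) ^ k ≤ 1) : a p lam k = 0 := by
  refine le_antisymm ?_ (a_nonneg hp hlam k)
  unfold a
  rw [Int.ceil_le]
  push_cast
  linarith

theorem a_mul {p : ℕ} (hp : p.Prime) (lam : ℝ) (k : ℤ) :
    a p ((p : ℝ) * lam) k = a p lam (k + 1) := by
  have hp0 : (p : ℝ) ≠ 0 := by exact_mod_cast hp.ne_zero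
  unfold a
  rw [zpow_add_one₀ hp0]
  congr 2
  ring

theorem abs_a_sub_le {p : ℕ} (hp : p.Prime) {lam : ℝ} (hlam : 0 < lam) (k : ℤ) :
    |((a p lam k - a p lam (k - 1) : ℤ) : ℝ)| ≤ lam * (p : ℝ) ^ k := by
  have hp1 : (1 : ℝ) ≤ p := by exact_mod_cast hp.one_le
  have h0 : (0 : ℝ) ≤ a p lam k := by exact_mod_cast a_nonneg hp hlam k
  have h1 : (0 : ℝ) ≤ a p lam (k - 1) := by exact_mod_cast a_nonneg hp hlam (k - 1)
  have h2 := a_le p lam k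
  have h3 := a_le p lam (k - 1)
  have h4 : lam * (p : ℝ) ^ (k - 1) ≤ lam * (p : ℝ) ^ k := by
    gcongr
    omega
  rw [abs_le]
  push_cast
  constructor <;> linarith

theorem exists_a_eq_zero {p : ℕ} (hp : p.Prime) {lam : ℝ} (hlam : 0 < lam) :
    ∃ N : ℤ, ∀ k ≤ N, a p lam k = 0 := by
  have hp1 : (1 : ℝ) < p := by exact_mod_cast hp.one_lt
  have hp0 : (0 : ℝ) < p := by linarith
  obtain ⟨n, hn⟩ := pow_unbounded_of_one_lt lam hp1
  refine ⟨-n, fun k hk => a_eq_zero hp hlam ?_⟩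
  calc lam * (p : ℝ) ^ k ≤ (p : ℝ) ^ n * (p : ℝ) ^ (-n : ℤ) := by
        gcongr
        exact hp1.le
    _ = 1 := by
        rw [zpow_neg, zpow_natCast]
        exact mul_inv_cancel₀ (by positivity)

theorem finite_neg_terms {p : ℕ} (hp : p.Prime) (β : ℝ) {lam : ℝ} (hlam : 0 < lam) :
    {k : ℤ | k < 0 ∧
      ((a p lam k - a p lam (k - 1) : ℤ) : ℝ) * (p : ℝ) ^ (-(k : ℝ) * β) ≠ 0}.Finite := by
  obtain ⟨N, hN⟩ := exists_a_eq_zero hp hlam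
  refine (Set.finite_Icc N 0).subset ?_
  rintro k ⟨hk, h⟩
  refine ⟨?_, hk.le⟩
  by_contra! hkN
  exact h (by simp [hN k hkN.le, hN (k - 1) (by omega)])

theorem summable_terms {p : ℕ} (hp : p.Prime) {β : ℝ} (hβ : 1 < β) {lam : ℝ} (hlam : 0 < lam) :
    Summable (fun k : ℤ =>
      ((a p lam k - a p lam (k - 1) : ℤ) : ℝ) * (p : ℝ) ^ (-(k : ℝ) * β)) := by
  have hp1 : (1 : ℝ) < p := by exact_mod_cast hp.one_lt
  have hp0 : (0 : ℝ) < p := by linarith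
  refine Summable.of_nat_of_neg_add_one ?_ ?_
  · have hr : (p : ℝ) ^ (1 - β) < 1 := Real.rpow_lt_one_of_one_lt_of_neg hp1 (by linarith)
    refine Summable.of_norm_bounded
      ((summable_geometric_of_lt_one (by positivity) hr).mul_left lam) fun n => ?_
    rw [norm_mul, Real.norm_eq_abs, Real.norm_of_nonneg (by positivity)]
    calc _ ≤ lam * (p : ℝ) ^ (n : ℤ) * (p : ℝ) ^ (-((n : ℤ) : ℝ) * β) := by
          gcongr
          exact abs_a_sub_le hp hlam n
      _ = lam * ((p : ℝ) ^ (1 - β)) ^ n := by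
          rw [mul_assoc, ← Real.rpow_intCast, ← Real.rpow_add hp0, ← Real.rpow_mul_natCast hp0.le]
          push_cast
          ring_nf
  · refine summable_of_hasFiniteSupport
      (((finite_neg_terms hp β hlam).preimage (f := fun n : ℕ => -((n : ℤ) + 1)) ?_).subset ?_)
    · intro m _ n _ h
      simpa using h
    · intro n hn
      have h : -((n : ℤ) + 1) < 0 := by omega
      exact ⟨h, hn⟩

theorem Zext_mul {p : ℕ} (hp : p.Prime) (β lam : ℝ) :
    Zext p ((p : ℝ) * lam) β = (p : ℝ) ^ β * Zext p lam β := by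
  have hp0 : (0 : ℝ) < p := by exact_mod_cast hp.pos
  unfold Zext
  rw [← (Equiv.addRight (1 : ℤ)).tsum_eq
    (fun k : ℤ => ((a p lam k - a p lam (k - 1) : ℤ) : ℝ) * (p : ℝ) ^ (-(k : ℝ) * β)),
    mul_left_comm, ← tsum_mul_left (a := (p : ℝ) ^ β)]
  congr 1
  refine tsum_congr fun k => ?_
  have h : (p : ℝ) ^ (-(k : ℝ) * β) = (p : ℝ) ^ β * (p : ℝ) ^ (-((k + 1 : ℤ) : ℝ) * β) := by
    rw [← Real.rpow_add hp0]
    push_cast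
    ring_nf
  rw [a_mul hp, a_mul hp, h, Equiv.coe_addRight, sub_add_cancel, add_sub_cancel_right]
  ring

/-- For a prime `p`, `β > 1` and any `λ > 0`, the doubly infinite series defining
`Zext_p(λ,β)` converges absolutely, only finitely many terms with `k < 0` are nonzero,
and `Zext_p(pλ,β) = p^β Zext_p(λ,β)`. -/
theorem Zext_functional_equation (p : ℕ) (hp : p.Prime) (β : ℝ) (hβ : 1 < β)
    (lam : ℝ) (hlam : 0 < lam) :
    Summable (fun k : ℤ =>
      |2 * ((a p lam k - a p lam (k - 1) : ℤ) : ℝ) * (p : ℝ) ^ (-(k : ℝ) * β)|) ∧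
    {k : ℤ | k < 0 ∧
      ((a p lam k - a p lam (k - 1) : ℤ) : ℝ) * (p : ℝ) ^ (-(k : ℝ) * β) ≠ 0}.Finite ∧
    Zext p ((p : ℝ) * lam) β = (p : ℝ) ^ β * Zext p lam β := by
  refine ⟨?_, finite_neg_terms hp β hlam, Zext_mul hp β lam⟩
  simpa only [mul_assoc] using ((summable_terms hp hβ hlam).mul_left 2).abs
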